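/- arXiv:1710.05368 — 2 statements merged into one kernel-verified Lean document; each statement's English description precedes it below -/
import Mathlib

section
/- Every reachable marking of an occurrence net is a cut. -/
/-- A Petri net over places `P` and transitions `T`: each transition has a
nonempty finite multiset precondition and postcondition (encoding the flow
relation `F`), and there is a finite initial marking. -/
structure PetriNet (P T : Type) where
  pre  : T → Multiset P
  post : T → Multiset P
  init : Multiset P
  pre_ne  : ∀ t, pre t ≠ 0
  post_ne : ∀ t, post t ≠ 0

namespace PetriNet

variable {P T : Type}

/-- A transition `t` is enabled in a marking `M` if `pre t ⊆ M`. -/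
def Enabled (N : PetriNet P T) (M : Multiset P) (t : T) : Prop :=
  N.pre t ≤ M

/-- `M →t M'`: firing an enabled transition. -/
def Fires [DecidableEq P] (N : PetriNet P T) (M : Multiset P) (t : T) (M' : Multiset P) : Prop :=
  N.pre t ≤ M ∧ M' = M - N.pre t + N.post t

def Step [DecidableEq P] (N : PetriNet P T) (M M' : Multiset P) : Prop :=
  ∃ t, N.Fires M t M'

/-- A marking is reachable if obtained from the initial marking by firing a
finite sequence of transitions. -/
def Reachable [DecidableEq P] (N : PetriNet P T) (M : Multiset P) : Prop :=
  Relation.ReflTransGen N.Step N.init M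

/-- The flow relation on nodes (places ⊕ transitions). -/
def Flow (N : PetriNet P T) : P ⊕ T → P ⊕ T → Prop
  | Sum.inl p, Sum.inr t => p ∈ N.pre t
  | Sum.inr t, Sum.inl p => p ∈ N.post t
  | _, _ => False

/-- `<` : transitive closure of the flow relation. -/
def CLt (N : PetriNet P T) : P ⊕ T → P ⊕ T → Prop := Relation.TransGen N.Flow

/-- `≤` : reflexive-transitive closure of the flow relation. -/
def CLe (N : PetriNet P T) : P ⊕ T → P ⊕ T → Prop := Relation.ReflTransGen N.Flow

/-- Nodes `x`, `y` are in conflict if from some place `q` (distinct from both)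
one can reach `x` and `y` via two different outgoing transitions of `q`. -/
def Conflict (N : PetriNet P T) (x y : P ⊕ T) : Prop :=
  ∃ q : P, Sum.inl q ≠ x ∧ Sum.inl q ≠ y ∧
    ∃ t₁ t₂ : T, t₁ ≠ t₂ ∧ q ∈ N.pre t₁ ∧ q ∈ N.pre t₂ ∧
      N.CLe (Sum.inr t₁) x ∧ N.CLe (Sum.inr t₂) y

/-- Concurrent: neither causally related nor in conflict. -/
def Concurrent (N : PetriNet P T) (x y : P ⊕ T) : Prop :=
  ¬ N.CLe x y ∧ ¬ N.CLe y x ∧ ¬ N.Conflict x y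

/-- Occurrence net: pre/postconditions are sets, every place has at most one
incoming transition, the initial marking is the set of places without incoming
transitions, the inverse flow relation is well-founded, and no transition is in
self-conflict. -/
structure IsOccurrence (N : PetriNet P T) : Prop where
  pre_nodup : ∀ t, (N.pre t).Nodup
  post_nodup : ∀ t, (N.post t).Nodup
  unique_pre : ∀ p : P, ∀ t₁ t₂ : T, p ∈ N.post t₁ → p ∈ N.post t₂ → t₁ = t₂
  init_nodup : N.init.Nodup
  mem_init : ∀ p : P, p ∈ N.init ↔ ∀ t : T, p ∉ N.post t
  wf : WellFounded N.Flow
  no_self_conflict : ∀ t : T, ¬ N.Conflict (Sum.inr t) (Sum.inr t)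

def PairwiseConcurrent (N : PetriNet P T) (C : Set P) : Prop :=
  ∀ p ∈ C, ∀ q ∈ C, p ≠ q → N.Concurrent (Sum.inl p) (Sum.inl q)

/-- A cut: a maximal set of pairwise concurrent places. -/
def IsCut (N : PetriNet P T) (C : Set P) : Prop :=
  N.PairwiseConcurrent C ∧ ∀ D : Set P, N.PairwiseConcurrent D → C ⊆ D → D = C

end PetriNet

/-- `(N₁, fP, fT)` is an initial branching process of `N₂`: `N₁` is an
occurrence net, `(fP, fT)` is an initial homomorphism, and transitions with the
same precondition and the same image coincide. -/
structure IsBranchingProcess {P₁ T₁ P₂ T₂ : Type}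
    (N₁ : PetriNet P₁ T₁) (N₂ : PetriNet P₂ T₂)
    (fP : P₁ → P₂) (fT : T₁ → T₂) : Prop where
  occ : N₁.IsOccurrence
  map_pre : ∀ t, (N₁.pre t).map fP = N₂.pre (fT t)
  map_post : ∀ t, (N₁.post t).map fP = N₂.post (fT t)
  map_init : N₁.init.map fP = N₂.init
  trans_inj : ∀ t₁ t₂, N₁.pre t₁ = N₁.pre t₂ → fT t₁ = fT t₂ → t₁ = t₂


namespace PetriNet

variable {P T : Type} {N : PetriNet P T}

theorem Conflict.symm {x y : P ⊕ T} (h : N.Conflict x y) : N.Conflict y x := by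
  obtain ⟨q, hx, hy, t₁, t₂, hne, h₁, h₂, l₁, l₂⟩ := h
  exact ⟨q, hy, hx, t₂, t₁, hne.symm, h₂, h₁, l₂, l₁⟩

theorem Concurrent.symm {x y : P ⊕ T} (h : N.Concurrent x y) : N.Concurrent y x :=
  ⟨h.2.1, h.1, fun hc => h.2.2 hc.symm⟩

theorem flow_pre {p : P} {t : T} (h : p ∈ N.pre t) : N.Flow (Sum.inl p) (Sum.inr t) := h

theorem flow_post {p : P} {t : T} (h : p ∈ N.post t) : N.Flow (Sum.inr t) (Sum.inl p) := h

theorem exists_mem_pre (N : PetriNet P T) (t : T) : ∃ p, p ∈ N.pre t :=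
  Multiset.exists_mem_of_ne_zero (N.pre_ne t)

theorem exists_mem_post (N : PetriNet P T) (t : T) : ∃ p, p ∈ N.post t :=
  Multiset.exists_mem_of_ne_zero (N.post_ne t)

/-- A node strictly below a place is below a transition producing that place. -/
theorem CLe.eq_or_exists_post {x : P ⊕ T} {p : P} (h : N.CLe x (Sum.inl p)) :
    x = Sum.inl p ∨ ∃ t, p ∈ N.post t ∧ N.CLe x (Sum.inr t) := by
  rcases Relation.ReflTransGen.cases_tail h with h | ⟨y, hy, hf⟩
  · exact .inl h.symm
  · rcases y with q | t
    · exact hf.elim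
    · exact .inr ⟨t, hf, hy⟩

/-- A node strictly below a transition is below one of its preconditions. -/
theorem CLe.eq_or_exists_pre {x : P ⊕ T} {t : T} (h : N.CLe x (Sum.inr t)) :
    x = Sum.inr t ∨ ∃ p, p ∈ N.pre t ∧ N.CLe x (Sum.inl p) := by
  rcases Relation.ReflTransGen.cases_tail h with h | ⟨y, hy, hf⟩
  · exact .inl h.symm
  · rcases y with q | t
    · exact .inr ⟨q, hf, hy⟩
    · exact hf.elim

/-- A node strictly above a place is above a transition consuming that place. -/
theorem CLe.eq_or_exists_consumer {x : P ⊕ T} {p : P} (h : N.CLe (Sum.inl p) x) :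
    x = Sum.inl p ∨ ∃ t, p ∈ N.pre t ∧ N.CLe (Sum.inr t) x := by
  rcases Relation.ReflTransGen.cases_head h with h | ⟨y, hf, hy⟩
  · exact .inl h.symm
  · rcases y with q | t
    · exact hf.elim
    · exact .inr ⟨t, hf, hy⟩

/-- A place above a transition is above one of its postconditions. -/
theorem CLe.exists_post {p : P} {t : T} (h : N.CLe (Sum.inr t) (Sum.inl p)) :
    ∃ q, q ∈ N.post t ∧ N.CLe (Sum.inl q) (Sum.inl p) := by
  rcases Relation.ReflTransGen.cases_head h with h | ⟨y, hf, hy⟩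
  · cases h
  · rcases y with q | t
    · exact ⟨q, hf, hy⟩
    · exact hf.elim

namespace IsOccurrence

variable (hN : N.IsOccurrence)
include hN

theorem not_cLe_of_flow {x y : P ⊕ T} (hf : N.Flow x y) : ¬ N.CLe y x := fun h =>
  (hN.wf.transGen.irrefl).irrefl x (Relation.TransGen.head' hf h)

theorem ne_of_mem_pre_of_cLe {p q : P} {t : T} (hp : p ∈ N.pre t)
    (h : N.CLe (Sum.inr t) (Sum.inl q)) : p ≠ q := by
  rintro rfl
  exact hN.not_cLe_of_flow (flow_pre hp) h

theorem cLe_of_mem_post {x : P ⊕ T} {p : P} {t : T} (hp : p ∈ N.post t)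
    (h : N.CLe x (Sum.inl p)) : x = Sum.inl p ∨ N.CLe x (Sum.inr t) := by
  rcases h.eq_or_exists_post with h | ⟨u, hu, h⟩
  · exact .inl h
  · exact .inr (hN.unique_pre p u t hu hp ▸ h)

theorem exists_init_cLe (x : P ⊕ T) : ∃ p ∈ N.init, N.CLe (Sum.inl p) x := by
  induction x using hN.wf.induction with
  | _ x ih =>
    rcases x with r | t
    · by_cases hr : r ∈ N.init
      · exact ⟨r, hr, .refl⟩
      · simp only [hN.mem_init, not_forall, not_not] at hr
        obtain ⟨t, ht⟩ := hr
        obtain ⟨p, hp, h⟩ := ih _ (flow_post ht)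
        exact ⟨p, hp, h.tail (flow_post ht)⟩
    · obtain ⟨s, hs⟩ := N.exists_mem_pre t
      obtain ⟨p, hp, h⟩ := ih _ (flow_pre hs)
      exact ⟨p, hp, h.tail (flow_pre hs)⟩

theorem eq_of_cLe_init {x : P ⊕ T} {p : P} (hp : p ∈ N.init)
    (h : N.CLe x (Sum.inl p)) : x = Sum.inl p := by
  rcases h.eq_or_exists_post with h | ⟨t, ht, -⟩
  · exact h
  · exact ((hN.mem_init p).1 hp t ht).elim

theorem concurrent_of_mem_init {p q : P} (hp : p ∈ N.init) (hq : q ∈ N.init) (hne : p ≠ q) :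
    N.Concurrent (Sum.inl p) (Sum.inl q) := by
  refine ⟨fun h => hne ?_, fun h => hne ?_, ?_⟩
  · exact Sum.inl_injective (hN.eq_of_cLe_init hq h)
  · exact (Sum.inl_injective (hN.eq_of_cLe_init hp h)).symm
  · rintro ⟨_, -, -, t, -, -, -, -, h, -⟩
    cases hN.eq_of_cLe_init hp h

theorem isCut_init : N.IsCut {p | p ∈ N.init} := by
  refine ⟨fun p hp q hq hne => hN.concurrent_of_mem_init hp hq hne, fun D hD hsub => ?_⟩
  refine Set.Subset.antisymm (fun r hr => ?_) hsub
  obtain ⟨p, hp, h⟩ := hN.exists_init_cLe (Sum.inl r)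
  by_contra hr'
  exact (hD p (hsub hp) r hr (by rintro rfl; exact hr' hp)).1 h

/-- Two distinct postconditions of the same transition are concurrent. -/
theorem concurrent_of_mem_post {p q : P} {t : T} (hp : p ∈ N.post t) (hq : q ∈ N.post t)
    (hne : p ≠ q) : N.Concurrent (Sum.inl p) (Sum.inl q) := by
  refine ⟨fun h => ?_, fun h => ?_, ?_⟩
  · rcases hN.cLe_of_mem_post hq h with h | h
    · exact hne (Sum.inl_injective h)
    · exact hN.not_cLe_of_flow (flow_post hp) h
  · rcases hN.cLe_of_mem_post hp h with h | h
    · exact hne (Sum.inl_injective h).symm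
    · exact hN.not_cLe_of_flow (flow_post hq) h
  · rintro ⟨u, -, -, t₁, t₂, h12, h₁, h₂, l₁, l₂⟩
    refine hN.no_self_conflict t ⟨u, Sum.inl_ne_inr, Sum.inl_ne_inr, t₁, t₂, h12, h₁, h₂, ?_, ?_⟩
    · exact (hN.cLe_of_mem_post hp l₁).resolve_left Sum.inr_ne_inl
    · exact (hN.cLe_of_mem_post hq l₂).resolve_left Sum.inr_ne_inl

/-- A place concurrent with all of `pre t` is concurrent with all of `post t`. -/
theorem concurrent_post {r p : P} {t : T}
    (hc : ∀ s ∈ N.pre t, N.Concurrent (Sum.inl r) (Sum.inl s)) (hp : p ∈ N.post t) :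
    N.Concurrent (Sum.inl r) (Sum.inl p) := by
  have not_above : ¬ N.CLe (Sum.inr t) (Sum.inl r) := fun h => by
    obtain ⟨s, hs⟩ := N.exists_mem_pre t
    exact (hc s hs).2.1 (h.head (flow_pre hs))
  refine ⟨fun h => ?_, fun h => not_above (h.head (flow_post hp)), ?_⟩
  · rcases hN.cLe_of_mem_post hp h with h | h
    · cases h
      exact not_above (.single (flow_post hp))
    · rcases h.eq_or_exists_pre with h | ⟨s, hs, h⟩
      · cases h
      · exact (hc s hs).1 h
  · rintro ⟨q, hqr, -, t₁, t₂, h12, h₁, h₂, l₁, l₂⟩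
    have l := (hN.cLe_of_mem_post hp l₂).resolve_left Sum.inr_ne_inl
    rcases l.eq_or_exists_pre with h | ⟨s, hs, h⟩
    · cases h
      exact (hc q h₂).2.1 (l₁.head (flow_pre h₁))
    · exact (hc s hs).2.2 ⟨q, hqr, Sum.inl_injective.ne (hN.ne_of_mem_pre_of_cLe h₂ h),
        t₁, t₂, h12, h₁, h₂, l₁, h⟩

/-- A place outside `pre t` and concurrent with all of `post t` is concurrent with `pre t`. -/
theorem concurrent_pre {r s : P} {t : T} (hr : r ∉ N.pre t)
    (hc : ∀ p ∈ N.post t, N.Concurrent (Sum.inl r) (Sum.inl p)) (hs : s ∈ N.pre t) :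
    N.Concurrent (Sum.inl r) (Sum.inl s) := by
  obtain ⟨p, hp⟩ := N.exists_mem_post t
  have hsp : N.Flow (Sum.inl s) (Sum.inr t) := flow_pre hs
  have htp : N.Flow (Sum.inr t) (Sum.inl p) := flow_post hp
  refine ⟨fun h => (hc p hp).1 ((h.tail hsp).tail htp), fun h => ?_, ?_⟩
  · rcases h.eq_or_exists_consumer with h | ⟨u, hu, h⟩
    · cases h
      exact hr hs
    · by_cases hut : u = t
      · subst hut
        obtain ⟨q, hq, h⟩ := h.exists_post
        exact (hc q hq).2.1 h
      · exact (hc p hp).2.2 ⟨s, Sum.inl_injective.ne (hN.ne_of_mem_pre_of_cLe hu h),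
          Sum.inl_injective.ne (hN.ne_of_mem_pre_of_cLe hs (.single htp)),
          u, t, hut, hu, hs, h, .single htp⟩
  · rintro ⟨q, hqr, -, t₁, t₂, h12, h₁, h₂, l₁, l₂⟩
    have l : N.CLe (Sum.inr t₂) (Sum.inl p) := (l₂.tail hsp).tail htp
    exact (hc p hp).2.2 ⟨q, hqr, Sum.inl_injective.ne (hN.ne_of_mem_pre_of_cLe h₂ l),
      t₁, t₂, h12, h₁, h₂, l₁, l⟩

/-- Firing a transition preserves cuts: the set of places `C` becomes
`(C \ pre t) ∪ post t`. -/
theorem isCut_fire {C : Set P} (hC : N.IsCut C) {t : T} (hpre : ∀ s ∈ N.pre t, s ∈ C) :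
    N.IsCut {p | (p ∈ C ∧ p ∉ N.pre t) ∨ p ∈ N.post t} := by
  obtain ⟨hconc, hmax⟩ := hC
  have hpost : ∀ r ∈ C, r ∉ N.pre t → ∀ p ∈ N.post t, N.Concurrent (Sum.inl r) (Sum.inl p) :=
    fun r hr hrt p hp => hN.concurrent_post
      (fun s hs => hconc r hr s (hpre s hs) (by rintro rfl; exact hrt hs)) hp
  refine ⟨?_, fun D hD hsub => Set.Subset.antisymm (fun r hr => ?_) hsub⟩
  · rintro p (⟨hp, hpt⟩ | hp) q (⟨hq, hqt⟩ | hq) hne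
    · exact hconc p hp q hq hne
    · exact hpost p hp hpt q hq
    · exact (hpost q hq hqt p hp).symm
    · exact hN.concurrent_of_mem_post hp hq hne
  · by_contra hr'
    have hcr : ∀ p, ((p ∈ C ∧ p ∉ N.pre t) ∨ p ∈ N.post t) →
        N.Concurrent (Sum.inl r) (Sum.inl p) :=
      fun p hp => hD r hr p (hsub hp) (by rintro rfl; exact hr' hp)
    have hrt : r ∉ N.pre t := fun h => by
      obtain ⟨p, hp⟩ := N.exists_mem_post t
      exact (hcr p (.inr hp)).1 ((Relation.ReflTransGen.single (flow_pre h)).tail (flow_post hp))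
    have hrC : ∀ p ∈ C, N.Concurrent (Sum.inl r) (Sum.inl p) := fun p hp => by
      by_cases hpt : p ∈ N.pre t
      · exact hN.concurrent_pre hrt (fun q hq => hcr q (.inr hq)) hpt
      · exact hcr p (.inl ⟨hp, hpt⟩)
    have hins : N.PairwiseConcurrent (insert r C) := by
      rintro p (rfl | hp) q (rfl | hq) hne
      · exact (hne rfl).elim
      · exact hrC q hq
      · exact (hrC p hp).symm
      · exact hconc p hp q hq hne
    have hmem : r ∈ C := hmax _ hins (Set.subset_insert r C) ▸ Set.mem_insert r C
    exact hr' (.inl ⟨hmem, hrt⟩)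

/-- A set of pairwise concurrent places containing `pre t` is disjoint from `post t`. -/
theorem notMem_post {C : Set P} (hC : N.PairwiseConcurrent C) {t : T}
    (hpre : ∀ s ∈ N.pre t, s ∈ C) {p : P} (hp : p ∈ C) : p ∉ N.post t := fun hpt => by
  obtain ⟨s, hs⟩ := N.exists_mem_pre t
  have l : N.CLe (Sum.inr t) (Sum.inl p) := .single (flow_post hpt)
  exact (hC s (hpre s hs) p hp (hN.ne_of_mem_pre_of_cLe hs l)).1 (l.head (flow_pre hs))

end IsOccurrence

end PetriNet

/-- Every reachable marking of an occurrence net is a cut (in particular it is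
a set). -/
theorem reachable_isCut {P T : Type} [DecidableEq P] (N : PetriNet P T)
    (hN : N.IsOccurrence) (M : Multiset P) (hM : N.Reachable M) :
    M.Nodup ∧ N.IsCut {p : P | p ∈ M} := by
  induction hM with
  | refl => exact ⟨hN.init_nodup, hN.isCut_init⟩
  | @tail M M' _ hstep ih =>
    obtain ⟨hnd, hcut⟩ := ih
    obtain ⟨t, hle, rfl⟩ := hstep
    have hpre : ∀ s ∈ N.pre t, s ∈ {p | p ∈ M} := fun s hs => Multiset.mem_of_le hle hs
    constructor
    · refine Multiset.nodup_add.2 ⟨Multiset.nodup_of_le (Multiset.sub_le_self _ _) hnd,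
        hN.post_nodup t, Multiset.disjoint_left.2 fun hp => ?_⟩
      exact hN.notMem_post hcut.1 hpre (Multiset.mem_of_le (Multiset.sub_le_self _ _) hp)
    · have hset : {p | p ∈ M - N.pre t + N.post t} =
          {p | (p ∈ {p | p ∈ M} ∧ p ∉ N.pre t) ∨ p ∈ N.post t} := by
        ext p
        simp [Multiset.mem_sub_of_nodup hnd]
      rw [hset]
      exact hN.isCut_fire hcut hpre
end

section
/- In an initial branching process (N^U, λ) of a k-bounded, finite Petri net N, every cut of N^U is finite. -/
namespace PetriNet

variable {P T : Type} {N : PetriNet P T}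

namespace IsOccurrence

theorem not_cLt_self (h : N.IsOccurrence) (x : P ⊕ T) : ¬ N.CLt x x :=
  fun hx => h.wf.transGen.irrefl.irrefl x hx

theorem finite_setOf_flow (h : N.IsOccurrence) (x : P ⊕ T) : {y | N.Flow y x}.Finite := by
  classical
  rcases x with p | t
  · refine Set.Subsingleton.finite ?_
    rintro (q | t) hy (q' | t') hy'
    · exact hy.elim
    · exact hy.elim
    · exact hy'.elim
    · exact congrArg Sum.inr (h.unique_pre p t t' hy hy')
  · refine ((N.pre t).toFinset.finite_toSet.image Sum.inl).subset ?_
    rintro (q | t') hy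
    · exact ⟨q, Multiset.mem_toFinset.2 hy, rfl⟩
    · exact hy.elim

theorem finite_setOf_cLe (h : N.IsOccurrence) (x : P ⊕ T) : {y | N.CLe y x}.Finite := by
  induction x using h.wf.induction with
  | _ x ih =>
    refine (((h.finite_setOf_flow x).biUnion ih).insert x).subset fun y hy => ?_
    rcases Relation.ReflTransGen.cases_tail hy with rfl | ⟨z, hyz, hzx⟩
    · exact Set.mem_insert _ _
    · exact Set.mem_insert_of_mem _ (Set.mem_biUnion (show z ∈ {y | N.Flow y x} from hzx) hyz)

end IsOccurrence

/-- A finite configuration: a causally closed and conflict-free set of transitions. -/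
structure IsConfiguration (N : PetriNet P T) (D : Finset T) : Prop where
  causallyClosed : ∀ t ∈ D, ∀ p ∈ N.pre t, ∀ t', p ∈ N.post t' → t' ∈ D
  conflictFree : ∀ t ∈ D, ∀ t' ∈ D, ∀ p ∈ N.pre t, p ∈ N.pre t' → t = t'

theorem IsOccurrence.exists_forall_post_notMem_pre (h : N.IsOccurrence) {D : Finset T}
    (hD : D.Nonempty) : ∃ t ∈ D, ∀ p ∈ N.post t, ∀ t' ∈ D, p ∉ N.pre t' := by
  let r : T → T → Prop := fun a b => N.CLt (Sum.inr b) (Sum.inr a)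
  have : IsStrictOrder T r :=
    { irrefl := fun a => h.not_cLt_self _
      trans := fun a b c hab hbc => Relation.TransGen.trans hbc hab }
  obtain ⟨t, ht, hmax⟩ := (D.finite_toSet.wellFoundedOn (r := r)).has_min
    (Set.univ : Set (D : Set T)) ⟨⟨_, hD.choose_spec⟩, trivial⟩
  refine ⟨t, t.2, fun p hp t' ht' hp' => hmax ⟨t', ht'⟩ trivial ?_⟩
  exact Relation.TransGen.head (b := Sum.inl p) hp (Relation.TransGen.single hp')

/-- The past of a finite set of pairwise concurrent places is a configuration that produces
these places and consumes none of them. -/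
theorem IsOccurrence.exists_isConfiguration (h : N.IsOccurrence) {F : Finset P}
    (hF : N.PairwiseConcurrent F) :
    ∃ D : Finset T, N.IsConfiguration D ∧
      ∀ p ∈ F, (p ∈ N.init ∨ ∃ t ∈ D, p ∈ N.post t) ∧ ∀ t ∈ D, p ∉ N.pre t := by
  have hfin : {t | ∃ p ∈ F, N.CLe (Sum.inr t) (Sum.inl p)}.Finite := by
    refine ((F.finite_toSet.biUnion fun p _ => h.finite_setOf_cLe (Sum.inl p)).preimage
      (Sum.inr_injective.injOn)).subset ?_
    rintro t ⟨p, hp, hle⟩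
    exact Set.mem_biUnion (show p ∈ (F : Set P) from hp) hle
  have consume : ∀ p ∈ F, ∀ t, ∀ q ∈ F, N.CLe (Sum.inr t) (Sum.inl q) → p ∉ N.pre t := by
    intro p hp t q hq hle hpt
    have hlt : N.CLt (Sum.inl p) (Sum.inl q) := Relation.TransGen.head' (b := Sum.inr t) hpt hle
    rcases eq_or_ne p q with rfl | hne
    · exact h.not_cLt_self _ hlt
    · exact (hF p hp q hq hne).1 hlt.to_reflTransGen
  refine ⟨hfin.toFinset, ⟨?_, ?_⟩, ?_⟩
  · intro t ht p hp t' hp'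
    rw [Set.Finite.mem_toFinset] at ht ⊢
    obtain ⟨q, hq, hle⟩ := ht
    exact ⟨q, hq, Relation.ReflTransGen.head (b := Sum.inl p) hp'
      (Relation.ReflTransGen.head (b := Sum.inr t) hp hle)⟩
  · intro t ht t' ht' p hp hp'
    rw [Set.Finite.mem_toFinset] at ht ht'
    obtain ⟨q, hq, hle⟩ := ht
    obtain ⟨q', hq', hle'⟩ := ht'
    by_contra hne
    rcases eq_or_ne q q' with rfl | hqq
    · obtain h0 | ⟨s, hs, hsq⟩ := Relation.ReflTransGen.cases_tail hle
      · cases h0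
      obtain h0 | ⟨s', hs', hsq'⟩ := Relation.ReflTransGen.cases_tail hle'
      · cases h0
      rcases s with _ | s
      · exact hsq.elim
      rcases s' with _ | s'
      · exact hsq'.elim
      obtain rfl := h.unique_pre q s s' hsq hsq'
      exact h.no_self_conflict s ⟨p, Sum.inl_ne_inr, Sum.inl_ne_inr, t, t', hne, hp, hp', hs, hs'⟩
    · refine (hF q hq q' hq' hqq).2.2 ⟨p, ?_, ?_, t, t', hne, hp, hp', hle, hle'⟩
      · rintro ⟨⟩
        exact consume _ hq t _ hq hle hp
      · rintro ⟨⟩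
        exact consume _ hq' t _ hq hle hp
  · intro p hp
    constructor
    · by_cases hi : p ∈ N.init
      · exact Or.inl hi
      · rw [h.mem_init] at hi
        push Not at hi
        obtain ⟨t, ht⟩ := hi
        exact Or.inr ⟨t, hfin.mem_toFinset.2 ⟨p, hp, Relation.ReflTransGen.single ht⟩, ht⟩
    · intro t ht
      obtain ⟨q, hq, hle⟩ := hfin.mem_toFinset.1 ht
      exact consume p hp t q hq hle

end PetriNet

/-- The marking reached by firing a configuration of a branching process maps to a reachable
marking of the underlying net. -/
theorem IsBranchingProcess.exists_reachable_map {P₁ T₁ P₂ T₂ : Type} [DecidableEq P₂]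
    {N₁ : PetriNet P₁ T₁} {N₂ : PetriNet P₂ T₂} {fP : P₁ → P₂} {fT : T₁ → T₂}
    (hbp : IsBranchingProcess N₁ N₂ fP fT) {D : Finset T₁} (hD : N₁.IsConfiguration D) :
    ∃ M : Multiset P₁, M.Nodup ∧
      (∀ p, p ∈ M ↔ (p ∈ N₁.init ∨ ∃ t ∈ D, p ∈ N₁.post t) ∧ ∀ t ∈ D, p ∉ N₁.pre t) ∧
      N₂.Reachable (M.map fP) := by
  classical
  have h := hbp.occ
  induction D using Finset.strongInduction with
  | _ D ih =>
    rcases D.eq_empty_or_nonempty with rfl | hne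
    · refine ⟨N₁.init, h.init_nodup, by simp, ?_⟩
      rw [hbp.map_init]
      exact Relation.ReflTransGen.refl
    obtain ⟨t, ht, hmax⟩ := h.exists_forall_post_notMem_pre hne
    have hD' : N₁.IsConfiguration (D.erase t) := by
      refine ⟨fun s hs p hp s' hp' => ?_, fun s hs s' hs' => hD.conflictFree s
        (Finset.mem_of_mem_erase hs) s' (Finset.mem_of_mem_erase hs')⟩
      have hsD := Finset.mem_of_mem_erase hs
      refine Finset.mem_erase.2 ⟨?_, hD.causallyClosed s hsD p hp s' hp'⟩
      rintro rfl
      exact hmax p hp' s hsD hp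
    obtain ⟨M, hM, hmem, hreach⟩ := ih _ (Finset.erase_ssubset ht) hD'
    have hle : N₁.pre t ≤ M := by
      refine (Multiset.le_iff_subset (h.pre_nodup t)).2 fun p hp => (hmem p).2 ⟨?_, ?_⟩
      · by_cases hi : p ∈ N₁.init
        · exact Or.inl hi
        · rw [h.mem_init] at hi
          push Not at hi
          obtain ⟨s, hs⟩ := hi
          refine Or.inr ⟨s, Finset.mem_erase.2 ⟨?_, hD.causallyClosed t ht p hp s hs⟩, hs⟩
          rintro rfl
          exact hmax p hs s ht hp
      · intro s hs hps
        exact (Finset.mem_erase.1 hs).1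
          (hD.conflictFree s (Finset.mem_of_mem_erase hs) t ht p hps hp)
    obtain ⟨X, rfl⟩ := Multiset.le_iff_exists_add.1 hle
    obtain ⟨-, hX, hdisj⟩ := Multiset.nodup_add.1 hM
    have hXmem : ∀ p, p ∈ X ↔ p ∈ N₁.pre t + X ∧ p ∉ N₁.pre t := fun p =>
      ⟨fun hp => ⟨Multiset.mem_add.2 (Or.inr hp), fun hp' => Multiset.disjoint_left.1 hdisj hp' hp⟩,
        fun hp => (Multiset.mem_add.1 hp.1).resolve_left hp.2⟩
    have hnew : ∀ p ∈ N₁.post t, p ∉ N₁.pre t + X := by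
      intro p hp hpM
      rcases ((hmem p).1 hpM).1 with hi | ⟨s, hs, hps⟩
      · exact (h.mem_init p).1 hi t hp
      · exact (Finset.mem_erase.1 hs).1 (h.unique_pre p s t hps hp)
    refine ⟨X + N₁.post t, Multiset.nodup_add.2 ⟨hX, h.post_nodup t, ?_⟩, fun p => ?_, ?_⟩
    · exact Multiset.disjoint_left.2 fun {p} hp hp' => hnew p hp' ((hXmem p).1 hp).1
    · rw [Multiset.mem_add, hXmem, hmem]
      constructor
      · rintro (⟨⟨hprod, hcons⟩, hpt⟩ | hp)
        · refine ⟨hprod.imp_right fun ⟨s, hs, hps⟩ => ⟨s, Finset.mem_of_mem_erase hs, hps⟩,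
            fun s hs => ?_⟩
          rcases eq_or_ne s t with rfl | hst
          · exact hpt
          · exact hcons s (Finset.mem_erase.2 ⟨hst, hs⟩)
        · exact ⟨Or.inr ⟨t, ht, hp⟩, hmax p hp⟩
      · rintro ⟨hprod, hcons⟩
        by_cases hp : p ∈ N₁.post t
        · exact Or.inr hp
        · refine Or.inl ⟨⟨hprod.imp_right ?_, fun s hs => hcons s (Finset.mem_of_mem_erase hs)⟩,
            hcons t ht⟩
          rintro ⟨s, hs, hps⟩
          refine ⟨s, Finset.mem_erase.2 ⟨?_, hs⟩, hps⟩
          rintro rfl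
          exact hp hps
    · refine Relation.ReflTransGen.tail hreach ⟨fT t, ?_, ?_⟩
      · rw [Multiset.map_add, hbp.map_pre]
        exact Multiset.le_add_right _ _
      · rw [Multiset.map_add, Multiset.map_add, hbp.map_pre, hbp.map_post, add_tsub_cancel_left]

theorem IsBranchingProcess.card_le_of_pairwiseConcurrent {P₁ T₁ P₂ T₂ : Type}
    [DecidableEq P₂] [Fintype P₂]
    {N₁ : PetriNet P₁ T₁} {N₂ : PetriNet P₂ T₂} {fP : P₁ → P₂} {fT : T₁ → T₂}
    (hbp : IsBranchingProcess N₁ N₂ fP fT) {k : ℕ}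
    (hbound : ∀ M, N₂.Reachable M → ∀ p : P₂, M.count p ≤ k)
    {F : Finset P₁} (hF : N₁.PairwiseConcurrent F) : F.card ≤ Fintype.card P₂ * k := by
  obtain ⟨D, hD, hFD⟩ := hbp.occ.exists_isConfiguration hF
  obtain ⟨M, -, hmem, hreach⟩ := hbp.exists_reachable_map hD
  have hle : F.val ≤ M := (Multiset.le_iff_subset F.nodup).2 fun p hp => (hmem p).2 (hFD p hp)
  calc F.card ≤ (M.map fP).card := by
        rw [Multiset.card_map]
        exact Multiset.card_le_card hle
    _ = ∑ p : P₂, (M.map fP).count p :=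
        (Multiset.sum_count_eq_card fun p _ => Finset.mem_univ p).symm
    _ ≤ Fintype.card P₂ * k := by
        simpa using Finset.sum_le_card_nsmul Finset.univ _ k fun p _ => hbound _ hreach p

/-- In an initial branching process of a `k`-bounded, finite net, every cut is
finite. -/
theorem branchingProcess_cut_finite {P₁ T₁ P₂ T₂ : Type}
    [DecidableEq P₂] [Finite P₂] [Finite T₂]
    (N₁ : PetriNet P₁ T₁) (N₂ : PetriNet P₂ T₂) (fP : P₁ → P₂) (fT : T₁ → T₂)
    (hbp : IsBranchingProcess N₁ N₂ fP fT)
    (k : ℕ) (hk : 1 ≤ k)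
    (hbound : ∀ M, N₂.Reachable M → ∀ p : P₂, M.count p ≤ k)
    (C : Set P₁) (hC : N₁.IsCut C) :
    C.Finite := by
  have := Fintype.ofFinite P₂
  by_contra hinf
  obtain ⟨F, hFC, hcard⟩ :=
    Set.Infinite.exists_subset_card_eq hinf (Fintype.card P₂ * k + 1)
  have hle := hbp.card_le_of_pairwiseConcurrent hbound (F := F)
    fun p hp q hq => hC.1 p (hFC hp) q (hFC hq)
  omega
end
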